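/- arXiv:2507.09178 — 2 statements merged into one kernel-verified Lean document; each statement's English description precedes it below -/
import Mathlib

section
/- Let d ≥ 1, κ > 0, α > d/2, and let k be the spectral Matérn kernel. Let u_1, …, u_m ∈ ℝ^d be pairwise distinct points, let w_1, …, w_m ∈ ℝ^d be arbitrary points, and let τ_1, …, τ_m > 0 be positive reals. Define the m × m matrix K̂ by K̂_{ij} = k(u_i − u_j) − k(u_i − w_j) e^{−κ²τ_j} − k(w_i − u_j) e^{−κ²τ_i} + k(w_i − w_j) e^{−κ²(τ_i + τ_j)}. Then K̂ is symmetric and positive definite, i.e. vᵀK̂v > 0 for every nonzero v ∈ ℝ^m. (This is the deterministic content of the paper's Theorem on positive definiteness of the coupled Monte Carlo estimator for Dirichlet boundaries: with w_i the hitting locations and τ_i > 0 the hitting times of independent Brownian motions started at the interior points u_i, the coupled estimator matrix is almost surely positive definite.) -/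
open MeasureTheory Real
open scoped RealInnerProductSpace

/-- The spectral Matérn kernel on `ℝ^d`. -/
noncomputable def maternKernel (d : ℕ) (κ α : ℝ) (x : EuclideanSpace ℝ (Fin d)) : ℝ :=
  ∫ ω : EuclideanSpace ℝ (Fin d), (κ ^ 2 + ‖ω‖ ^ 2) ^ (-α) * Real.cos ⟪x, ω⟫

/-- The character `ω ↦ exp (i ⟪x, ω⟫)`, as a homomorphism into `ℂ`. -/
noncomputable def innerChar {E : Type*} [NormedAddCommGroup E] [InnerProductSpace ℝ E] (x : E) :
    Multiplicative E →* ℂ where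
  toFun ω := Complex.exp ((⟪x, ω.toAdd⟫ : ℝ) * Complex.I)
  map_one' := by simp
  map_mul' a b := by
    rw [← Complex.exp_add, toAdd_mul, inner_add_right]
    push_cast
    ring_nf

theorem innerChar_injective {E : Type*} [NormedAddCommGroup E] [InnerProductSpace ℝ E] :
    Function.Injective (innerChar : E → Multiplicative E →* ℂ) := by
  intro x y h
  by_contra hxy
  have hz : ⟪x - y, x - y⟫ ≠ 0 := inner_self_ne_zero.mpr (sub_ne_zero.mpr hxy)
  have h1 := DFunLike.congr_fun h (Multiplicative.ofAdd ((π / ⟪x - y, x - y⟫) • (x - y)))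
  simp only [innerChar, MonoidHom.coe_mk, OneHom.coe_mk, toAdd_ofAdd] at h1
  have hx : ⟪x, (π / ⟪x - y, x - y⟫) • (x - y)⟫
      = π + ⟪y, (π / ⟪x - y, x - y⟫) • (x - y)⟫ := by
    rw [← sub_eq_iff_eq_add, ← inner_sub_left, real_inner_smul_right, div_mul_cancel₀ _ hz]
  rw [hx, Complex.ofReal_add, add_mul, Complex.exp_add, Complex.exp_pi_mul_I] at h1
  have hne := Complex.exp_ne_zero
    ((⟪y, (π / ⟪x - y, x - y⟫) • (x - y)⟫ : ℝ) * Complex.I)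
  exact hne (by linear_combination (-1 / 2 : ℂ) * h1)

theorem linearIndependent_innerChar {E : Type*} [NormedAddCommGroup E] [InnerProductSpace ℝ E] :
    LinearIndependent ℂ fun x : E => (innerChar x : Multiplicative E → ℂ) :=
  (linearIndependent_monoidHom (Multiplicative E) ℂ).comp _ innerChar_injective

/-- Distinct point masses cannot be balanced by strictly contracted ones. -/
theorem eq_zero_of_sum_single_eq {ι E : Type*} [Fintype ι] {u w : ι → E}
    (hu : Function.Injective u) {c : ι → ℝ} (hc0 : ∀ i, 0 ≤ c i) (hc1 : ∀ i, c i < 1)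
    {v : ι → ℝ}
    (h : ∑ i, (Finsupp.single (u i) (v i : ℂ) - Finsupp.single (w i) ((c i * v i : ℝ) : ℂ)) = 0) :
    v = 0 := by
  classical
  have hv : ∀ j, v j = ∑ i, if w i = u j then c i * v i else 0 := by
    intro j
    have hj := DFunLike.congr_fun h (u j)
    simp only [Finsupp.finsetSum_apply, Finsupp.sub_apply, Finsupp.single_apply,
      Finset.sum_sub_distrib, hu.eq_iff, Finset.sum_ite_eq', Finset.mem_univ, if_true,
      Finsupp.coe_zero, Pi.zero_apply, sub_eq_zero] at hj
    have hj' := congrArg Complex.re hj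
    simpa [apply_ite Complex.re] using hj'
  have hle : ∑ j, |v j| ≤ ∑ i, c i * |v i| := calc
    ∑ j, |v j| ≤ ∑ j, ∑ i, if w i = u j then c i * |v i| else 0 := by
      refine Finset.sum_le_sum fun j _ => ?_
      conv_lhs => rw [hv j]
      refine (Finset.abs_sum_le_sum_abs _ _).trans (Finset.sum_le_sum fun i _ => ?_)
      split_ifs
      · rw [abs_mul, abs_of_nonneg (hc0 i)]
      · simp
    _ = ∑ i, ∑ j, if w i = u j then c i * |v i| else 0 := Finset.sum_comm
    _ ≤ ∑ i, c i * |v i| := by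
      refine Finset.sum_le_sum fun i _ => ?_
      rw [← Finset.sum_filter, Finset.sum_const, nsmul_eq_mul]
      have hcard : (Finset.univ.filter fun j => w i = u j).card ≤ 1 :=
        Finset.card_le_one.mpr fun a ha b hb => hu <| by
          rw [← (Finset.mem_filter.mp ha).2, ← (Finset.mem_filter.mp hb).2]
      exact mul_le_of_le_one_left (mul_nonneg (hc0 i) (abs_nonneg _)) (by exact_mod_cast hcard)
  have hterm : ∀ i, 0 ≤ (1 - c i) * |v i| := fun i =>
    mul_nonneg (sub_nonneg.mpr (hc1 i).le) (abs_nonneg _)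
  have hsum : ∑ i, (1 - c i) * |v i| = 0 := by
    refine le_antisymm ?_ (Finset.sum_nonneg fun i _ => hterm i)
    simp only [sub_mul, one_mul, Finset.sum_sub_distrib]
    linarith
  funext i
  have hi := (Finset.sum_eq_zero_iff_of_nonneg fun i _ => hterm i).mp hsum i (Finset.mem_univ i)
  exact abs_eq_zero.mp ((mul_eq_zero.mp hi).resolve_left (sub_ne_zero.mpr (hc1 i).ne'))

/-- A contracted difference of characters vanishing identically has zero coefficients. -/
theorem eq_zero_of_sum_cos_sin_eq_zero {ι E : Type*} [Fintype ι]
    [NormedAddCommGroup E] [InnerProductSpace ℝ E] {u w : ι → E}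
    (hu : Function.Injective u) {c : ι → ℝ} (hc0 : ∀ i, 0 ≤ c i) (hc1 : ∀ i, c i < 1)
    {v : ι → ℝ}
    (hcos : ∀ ω, ∑ i, v i * (Real.cos ⟪u i, ω⟫ - c i * Real.cos ⟪w i, ω⟫) = 0)
    (hsin : ∀ ω, ∑ i, v i * (Real.sin ⟪u i, ω⟫ - c i * Real.sin ⟪w i, ω⟫) = 0) :
    v = 0 := by
  refine eq_zero_of_sum_single_eq (w := w) hu hc0 hc1
    (linearIndependent_iff.mp linearIndependent_innerChar _ ?_)
  simp only [map_sum, map_sub, Finsupp.linearCombination_single]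
  funext ω
  simp only [Finset.sum_apply, Pi.sub_apply, Pi.smul_apply, smul_eq_mul, innerChar,
    MonoidHom.coe_mk, OneHom.coe_mk, Pi.zero_apply, Complex.exp_mul_I]
  have h1 := congrArg (fun r : ℝ => (r : ℂ)) (hcos ω.toAdd)
  have h2 := congrArg (fun r : ℝ => (r : ℂ)) (hsin ω.toAdd)
  push_cast at h1 h2 ⊢
  have h3 := congrArg₂ (fun a b : ℂ => a + b * Complex.I) h1 h2
  simp only [Finset.sum_mul, ← Finset.sum_add_distrib, zero_mul, add_zero] at h3
  refine Eq.trans ?_ h3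
  exact Finset.sum_congr rfl fun i _ => by ring

theorem continuous_matern_density {E : Type*} [NormedAddCommGroup E] {κ : ℝ} (hκ : 0 < κ) (α : ℝ) :
    Continuous fun ω : E => (κ ^ 2 + ‖ω‖ ^ 2) ^ (-α) :=
  Continuous.rpow_const (by fun_prop) fun ω => Or.inl (by positivity)

theorem integrable_matern_density {d : ℕ} {κ α : ℝ} (hκ : 0 < κ) (hα : (d : ℝ) / 2 < α) :
    Integrable fun ω : EuclideanSpace ℝ (Fin d) => (κ ^ 2 + ‖ω‖ ^ 2) ^ (-α) := by
  have hα0 : 0 < α := lt_of_le_of_lt (by positivity) hα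
  have hint : Integrable fun ω : EuclideanSpace ℝ (Fin d) => (1 + ‖ω‖ ^ 2) ^ (-(2 * α) / 2) :=
    integrable_rpow_neg_one_add_norm_sq (by rw [finrank_euclideanSpace_fin]; linarith)
  refine (hint.const_mul (min (κ ^ 2) 1 ^ (-α))).mono'
    (continuous_matern_density hκ α).aestronglyMeasurable (.of_forall fun ω => ?_)
  have hmin : 0 < min (κ ^ 2) 1 := lt_min (by positivity) one_pos
  rw [Real.norm_of_nonneg (by positivity), show -(2 * α) / 2 = -α by ring,
    ← Real.mul_rpow hmin.le (by positivity)]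
  refine Real.rpow_le_rpow_of_nonpos (by positivity) ?_ (by linarith)
  have h1 := min_le_left (κ ^ 2) 1
  have h2 := mul_le_mul_of_nonneg_right (min_le_right (κ ^ 2) 1) (sq_nonneg ‖ω‖)
  linarith

theorem integrable_maternKernel {d : ℕ} {κ α : ℝ} (hκ : 0 < κ) (hα : (d : ℝ) / 2 < α)
    (x : EuclideanSpace ℝ (Fin d)) :
    Integrable fun ω : EuclideanSpace ℝ (Fin d) =>
      (κ ^ 2 + ‖ω‖ ^ 2) ^ (-α) * Real.cos ⟪x, ω⟫ :=
  (integrable_matern_density hκ hα).mul_bdd (c := 1)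
    (Continuous.aestronglyMeasurable (by fun_prop)) (.of_forall fun _ => Real.abs_cos_le_one _)

theorem maternKernel_neg (d : ℕ) (κ α : ℝ) (x : EuclideanSpace ℝ (Fin d)) :
    maternKernel d κ α (-x) = maternKernel d κ α x := by
  simp [maternKernel]

theorem maternKernel_sub_comm (d : ℕ) (κ α : ℝ) (x y : EuclideanSpace ℝ (Fin d)) :
    maternKernel d κ α (x - y) = maternKernel d κ α (y - x) := by
  rw [← maternKernel_neg, neg_sub]

/-- The kernel applied to two contracted differences of point masses, in spectral form. -/
theorem integrable_and_integral_maternKernel_contracted {d : ℕ} {κ α : ℝ} (hκ : 0 < κ)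
    (hα : (d : ℝ) / 2 < α) (x y x' y' : EuclideanSpace ℝ (Fin d)) (a b : ℝ) :
    let F := fun ω : EuclideanSpace ℝ (Fin d) => (κ ^ 2 + ‖ω‖ ^ 2) ^ (-α) *
      ((Real.cos ⟪x, ω⟫ - a * Real.cos ⟪y, ω⟫) * (Real.cos ⟪x', ω⟫ - b * Real.cos ⟪y', ω⟫) +
        (Real.sin ⟪x, ω⟫ - a * Real.sin ⟪y, ω⟫) * (Real.sin ⟪x', ω⟫ - b * Real.sin ⟪y', ω⟫))
    Integrable F ∧ ∫ ω, F ω =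
      maternKernel d κ α (x - x') - maternKernel d κ α (x - y') * b
        - maternKernel d κ α (y - x') * a + maternKernel d κ α (y - y') * (a * b) := by
  intro F
  let f := fun (z : EuclideanSpace ℝ (Fin d)) (r : ℝ) (ω : EuclideanSpace ℝ (Fin d)) =>
    (κ ^ 2 + ‖ω‖ ^ 2) ^ (-α) * Real.cos ⟪z, ω⟫ * r
  have hf : ∀ z r, Integrable (f z r) := fun z r =>
    (integrable_maternKernel hκ hα z).mul_const r
  have hf_integral : ∀ z r, ∫ ω, f z r ω = maternKernel d κ α z * r := fun z r =>
    integral_mul_const r _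
  have hF : F = f (x - x') 1 - f (x - y') b - f (y - x') a + f (y - y') (a * b) := by
    funext ω
    simp only [F, f, Pi.add_apply, Pi.sub_apply, inner_sub_left, Real.cos_sub]
    ring
  have h12 := (hf (x - x') 1).sub (hf (x - y') b)
  have h123 := h12.sub (hf (y - x') a)
  rw [hF]
  refine ⟨h123.add (hf _ _), ?_⟩
  rw [integral_add' h123 (hf _ _), integral_sub' h12 (hf _ _), integral_sub' (hf _ _) (hf _ _)]
  simp only [hf_integral, mul_one]

/-- Positive definiteness of the coupled Monte Carlo kernel matrix estimator for
Dirichlet boundaries (deterministic content): with `w i` the hitting locations and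
`τ i > 0` the hitting times, the coupled estimator matrix is symmetric and
positive definite. -/
theorem coupled_MC_estimator_posDef (d : ℕ) (hd : 1 ≤ d) (κ α : ℝ)
    (hκ : 0 < κ) (hα : (d : ℝ) / 2 < α) (m : ℕ) (hm : 1 ≤ m)
    (u : Fin m → EuclideanSpace ℝ (Fin d)) (hu : Function.Injective u)
    (w : Fin m → EuclideanSpace ℝ (Fin d)) (τ : Fin m → ℝ) (hτ : ∀ i, 0 < τ i) :
    let k := maternKernel d κ α
    let Khat : Matrix (Fin m) (Fin m) ℝ := Matrix.of fun i j =>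
      k (u i - u j) - k (u i - w j) * Real.exp (-κ ^ 2 * τ j)
        - k (w i - u j) * Real.exp (-κ ^ 2 * τ i)
        + k (w i - w j) * Real.exp (-κ ^ 2 * (τ i + τ j))
    Khat.IsSymm ∧ Khat.PosDef := by
  intro k Khat
  have hsymm : Khat.IsSymm := by
    refine Matrix.IsSymm.ext fun i j => ?_
    simp only [Khat, k, Matrix.of_apply]
    rw [maternKernel_sub_comm d κ α (u j) (u i), maternKernel_sub_comm d κ α (u j) (w i),
      maternKernel_sub_comm d κ α (w j) (u i), maternKernel_sub_comm d κ α (w j) (w i),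
      add_comm (τ j) (τ i)]
    ring
  refine ⟨hsymm, .of_dotProduct_mulVec_pos hsymm fun v hv => ?_⟩
  set c : Fin m → ℝ := fun i => Real.exp (-κ ^ 2 * τ i)
  have hc1 : ∀ i, c i < 1 := fun i => Real.exp_lt_one_iff.mpr <| by
    have := mul_pos (pow_pos hκ 2) (hτ i)
    linarith
  set p : EuclideanSpace ℝ (Fin d) → ℝ := fun ω => (κ ^ 2 + ‖ω‖ ^ 2) ^ (-α)
  set A : Fin m → EuclideanSpace ℝ (Fin d) → ℝ :=
    fun i ω => Real.cos ⟪u i, ω⟫ - c i * Real.cos ⟪w i, ω⟫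
  set B : Fin m → EuclideanSpace ℝ (Fin d) → ℝ :=
    fun i ω => Real.sin ⟪u i, ω⟫ - c i * Real.sin ⟪w i, ω⟫
  have hK : ∀ i j, Integrable (fun ω => p ω * (A i ω * A j ω + B i ω * B j ω)) ∧
      ∫ ω, p ω * (A i ω * A j ω + B i ω * B j ω) = Khat i j := by
    intro i j
    have h := integrable_and_integral_maternKernel_contracted hκ hα (u i) (w i) (u j) (w j) (c i) (c j)
    refine ⟨h.1, h.2.trans ?_⟩
    simp only [Khat, k, Matrix.of_apply, c, mul_add, Real.exp_add]
  set G : EuclideanSpace ℝ (Fin d) → ℝ :=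
    fun ω => p ω * ((∑ i, v i * A i ω) ^ 2 + (∑ i, v i * B i ω) ^ 2)
  have hG : G = fun ω => ∑ i, ∑ j, v i * v j * (p ω * (A i ω * A j ω + B i ω * B j ω)) := by
    funext ω
    simp only [G]
    rw [sq, sq, Finset.sum_mul_sum, Finset.sum_mul_sum]
    simp only [← Finset.sum_add_distrib, Finset.mul_sum]
    exact Finset.sum_congr rfl fun i _ => Finset.sum_congr rfl fun j _ => by ring
  have hint : ∀ i j, Integrable fun ω => v i * v j * (p ω * (A i ω * A j ω + B i ω * B j ω)) :=
    fun i j => (hK i j).1.const_mul _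
  have hGint : Integrable G := by
    rw [hG]
    exact integrable_finsetSum _ fun i _ => integrable_finsetSum _ fun j _ => hint i j
  have hquad : star v ⬝ᵥ Khat.mulVec v = ∫ ω, G ω := by
    rw [hG, integral_finsetSum _ fun i _ => integrable_finsetSum _ fun j _ => hint i j]
    simp only [dotProduct, Matrix.mulVec, star_trivial, Finset.mul_sum]
    refine Finset.sum_congr rfl fun i _ => ?_
    rw [integral_finsetSum _ fun j _ => hint i j]
    refine Finset.sum_congr rfl fun j _ => ?_
    rw [integral_const_mul, (hK i j).2]
    ring
  have hp : ∀ ω, 0 < p ω := fun ω => by positivity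
  have hGcont : Continuous G :=
    (continuous_matern_density hκ α).mul (by fun_prop)
  have hGne : ∃ ω, G ω ≠ 0 := by
    by_contra! hzero
    have hsq : ∀ ω, (∑ i, v i * A i ω) ^ 2 + (∑ i, v i * B i ω) ^ 2 = 0 := fun ω =>
      (mul_eq_zero.mp (hzero ω)).resolve_left (hp ω).ne'
    refine hv (eq_zero_of_sum_cos_sin_eq_zero (w := w) hu (fun i => (Real.exp_pos _).le) hc1
      (fun ω => ?_) fun ω => ?_)
    · exact pow_eq_zero_iff two_ne_zero |>.mp
        ((add_eq_zero_iff_of_nonneg (sq_nonneg _) (sq_nonneg _)).mp (hsq ω)).1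
    · exact pow_eq_zero_iff two_ne_zero |>.mp
        ((add_eq_zero_iff_of_nonneg (sq_nonneg _) (sq_nonneg _)).mp (hsq ω)).2
  obtain ⟨ω, hω⟩ := hGne
  rw [hquad]
  exact integral_pos_of_integrable_nonneg_nonzero hGcont hGint
    (fun ω => mul_nonneg (hp ω).le (by positivity)) hω
end

section
/- Let κ > 0, ω ∈ ℝ, and c ≥ 0 with cκ ≠ 1. Define the complex-valued functions on ℝ: f_p(x) = e^{iωx} / (κ² + ω²), f_h(x) = [(e^κ − e^{iω})(1 + icω) e^{−κx}] / [2(1 − cκ) sinh(κ)(κ² + ω²)] + [(e^{iω} − e^{−κ})(1 + icω) e^{κx}] / [2(1 + cκ) sinh(κ)(κ² + ω²)], and f = f_p − f_h. Then f is twice differentiable on ℝ and solves the Robin boundary value problem for the one-dimensional Helmholtz operator on [0,1]: κ² f(x) − f''(x) = e^{iωx} for all x ∈ ℝ, f(0) + c f'(0) = 0, and f(1) + c f'(1) = 0. -/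
open Complex

/-- A combination of three complex exponentials in a real variable is differentiated termwise. -/
theorem hasDerivAt_exp_combination (A B C a b d : ℂ) (x : ℝ) :
    HasDerivAt (fun x : ℝ => A * exp (a * x) + B * exp (b * x) + C * exp (d * x))
      (A * a * exp (a * x) + B * b * exp (b * x) + C * d * exp (d * x)) x := by
  have key : ∀ A a : ℂ, HasDerivAt (fun x : ℝ => A * exp (a * x)) (A * a * exp (a * x)) x := by
    intro A a
    have h : HasDerivAt (fun z : ℂ => A * exp (a * z)) (A * a * exp (a * x)) (x : ℂ) := by
      simpa [mul_assoc, mul_comm, mul_left_comm] using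
        ((hasDerivAt_id (x : ℂ)).const_mul a).cexp.const_mul A
    exact h.comp_ofReal
  exact ((key A a).add (key B b)).add (key C d)

/-- Explicit solution to the one-dimensional Helmholtz equation with homogeneous
Robin boundary conditions at `x = 0, 1`. -/
theorem helmholtz_robin_explicit_solution (κ ω c : ℝ) (hκ : 0 < κ) (hc : 0 ≤ c)
    (hcκ : c * κ ≠ 1) :
    let fp : ℝ → ℂ := fun x => Complex.exp (I * ω * x) / ((κ : ℂ) ^ 2 + (ω : ℂ) ^ 2)
    let fh : ℝ → ℂ := fun x =>
      (Complex.exp κ - Complex.exp (I * ω)) * (1 + I * c * ω) * Complex.exp (-(κ : ℂ) * x)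
          / (2 * (1 - (c : ℂ) * κ) * (Real.sinh κ : ℂ) * ((κ : ℂ) ^ 2 + (ω : ℂ) ^ 2))
        + (Complex.exp (I * ω) - Complex.exp (-(κ : ℂ))) * (1 + I * c * ω)
            * Complex.exp ((κ : ℂ) * x)
          / (2 * (1 + (c : ℂ) * κ) * (Real.sinh κ : ℂ) * ((κ : ℂ) ^ 2 + (ω : ℂ) ^ 2))
    let f : ℝ → ℂ := fun x => fp x - fh x
    (∀ x : ℝ, DifferentiableAt ℝ f x) ∧
    (∀ x : ℝ, DifferentiableAt ℝ (deriv f) x) ∧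
    (∀ x : ℝ, (κ : ℂ) ^ 2 * f x - deriv (deriv f) x = Complex.exp (I * ω * x)) ∧
    f 0 + (c : ℂ) * deriv f 0 = 0 ∧
    f 1 + (c : ℂ) * deriv f 1 = 0 := by
  intro fp fh f
  have hD : (κ : ℂ) ^ 2 + (ω : ℂ) ^ 2 ≠ 0 := by
    have h : κ ^ 2 + ω ^ 2 ≠ 0 := by positivity
    exact_mod_cast h
  have hS : (Real.sinh κ : ℂ) ≠ 0 := by
    exact_mod_cast (Real.sinh_pos_iff.2 hκ).ne'
  have hm : 1 - (c : ℂ) * κ ≠ 0 := by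
    have h : 1 - c * κ ≠ 0 := sub_ne_zero.2 hcκ.symm
    exact_mod_cast h
  have hp : 1 + (c : ℂ) * κ ≠ 0 := by
    have h : 1 + c * κ ≠ 0 := by positivity
    exact_mod_cast h
  have hsinh : 2 * (Real.sinh κ : ℂ) = exp κ - exp (-(κ : ℂ)) := by
    rw [ofReal_sinh, two_sinh]
  set D : ℂ := (κ : ℂ) ^ 2 + (ω : ℂ) ^ 2 with hDdef
  set S : ℂ := (Real.sinh κ : ℂ)
  set A : ℂ := 1 / D with hA
  set B : ℂ := -((exp κ - exp (I * ω)) * (1 + I * c * ω) / (2 * (1 - (c : ℂ) * κ) * S * D)) with hB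
  set C : ℂ := -((exp (I * ω) - exp (-(κ : ℂ))) * (1 + I * c * ω)
    / (2 * (1 + (c : ℂ) * κ) * S * D)) with hC
  have hf : f = fun x : ℝ =>
      A * exp (I * ω * x) + B * exp (-(κ : ℂ) * x) + C * exp ((κ : ℂ) * x) := by
    funext x
    simp only [f, fp, fh, hA, hB, hC]
    ring
  have hf' : ∀ x : ℝ, HasDerivAt f (A * (I * ω) * exp (I * ω * x)
      + B * -(κ : ℂ) * exp (-(κ : ℂ) * x) + C * κ * exp ((κ : ℂ) * x)) x := by
    rw [hf]
    exact hasDerivAt_exp_combination A B C _ _ _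
  have hderiv : deriv f = fun x : ℝ => A * (I * ω) * exp (I * ω * x)
      + B * -(κ : ℂ) * exp (-(κ : ℂ) * x) + C * κ * exp ((κ : ℂ) * x) :=
    funext fun x => (hf' x).deriv
  have hf'' := hasDerivAt_exp_combination (A * (I * ω)) (B * -(κ : ℂ)) (C * κ)
    (I * ω) (-(κ : ℂ)) κ
  have hAD : A * D = 1 := by rw [hA]; field_simp
  have hBm : B * (1 - (c : ℂ) * κ) * (2 * S) = -((exp κ - exp (I * ω)) * (1 + I * c * ω) * A) := by
    rw [hB, hA]; field_simp
  have hCp : C * (1 + (c : ℂ) * κ) * (2 * S)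
      = -((exp (I * ω) - exp (-(κ : ℂ))) * (1 + I * c * ω) * A) := by
    have hp' : 1 + (κ : ℂ) * c ≠ 0 := by rwa [mul_comm (κ : ℂ)]
    rw [hC, hA]; field_simp
  have hS2 : 2 * S ≠ 0 := mul_ne_zero two_ne_zero hS
  clear_value A B C S D
  refine ⟨fun x => (hf' x).differentiableAt, fun x => ?_, fun x => ?_, ?_, ?_⟩
  · rw [hderiv]
    exact (hf'' x).differentiableAt
  · rw [hderiv, (hf'' x).deriv, hf]
    linear_combination exp (I * ω * x) * hAD - A * exp (I * ω * x) * hDdef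
      - A * ω ^ 2 * exp (I * ω * x) * I_sq
  · rw [hderiv, hf]
    simp only [ofReal_zero, mul_zero, exp_zero, mul_one]
    refine mul_right_cancel₀ hS2 ?_
    linear_combination hBm + hCp + A * (1 + I * c * ω) * hsinh
  · rw [hderiv, hf]
    simp only [ofReal_one, mul_one]
    refine mul_right_cancel₀ hS2 ?_
    linear_combination exp (-(κ : ℂ)) * hBm + exp κ * hCp
      + A * (1 + I * c * ω) * exp (I * ω) * hsinh
end
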